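/- arXiv:2206.02174 — 2 statements merged into one kernel-verified Lean document; each statement's English description precedes it below -/
import Mathlib

section
/- For every nonnegative ω ∈ L¹(Π) ∩ L²(Π), one has 𝒢ω(x) → 0 as |x| → ∞ with x ∈ Π. -/
open MeasureTheory Real Filter

noncomputable section

/-- The upper half plane `Π = {x ∈ ℝ² : x₂ > 0}`. -/
def UHP : Set (ℝ × ℝ) := {x | 0 < x.2}

/-- Euclidean norm of a point of `ℝ²`. -/
def rad (x : ℝ × ℝ) : ℝ := Real.sqrt (x.1 ^ 2 + x.2 ^ 2)

/-- Modified Bessel function of the second kind of order `0`: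
`K₀(r) = ∫₀^∞ exp(-r cosh t) dt`. -/
def K0 (r : ℝ) : ℝ := ∫ t in Set.Ioi (0 : ℝ), Real.exp (-(r * Real.cosh t))

/-- Fundamental solution `G(x,y) = (1/2π) K₀(|x-y|)` of `−Δ + Id` on `ℝ²`. -/
def Gker (x y : ℝ × ℝ) : ℝ := (1 / (2 * Real.pi)) * K0 (rad (x - y))

/-- Reflection `x̄ = (x₁, −x₂)` across the `x₁`-axis. -/
def reflPt (x : ℝ × ℝ) : ℝ × ℝ := (x.1, -x.2)

/-- Green's function `G_Π(x,y) = G(x,y) − G(x̄,y)` of `−Δ + Id` on the half plane. -/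
def GUHP (x y : ℝ × ℝ) : ℝ := Gker x y - Gker (reflPt x) y

/-- The operator `𝒢ω(x) = ∫_Π G_Π(x,y) ω(y) dy`. -/
def Gop (ω : ℝ × ℝ → ℝ) (x : ℝ × ℝ) : ℝ := ∫ y in UHP, GUHP x y * ω y

/-- Kinetic energy `E(ω) = (1/2) ∫_Π ω 𝒢ω`. -/
def kineticE (ω : ℝ × ℝ → ℝ) : ℝ := (1 / 2) * ∫ x in UHP, ω x * Gop ω x

/-- Impulse `I(ω) = ∫_Π x₂ ω dx`. -/
def impulse (ω : ℝ × ℝ → ℝ) : ℝ := ∫ x in UHP, x.2 * ω x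

/-- `L¹(Π)` norm. -/
def normL1 (f : ℝ × ℝ → ℝ) : ℝ := ∫ x in UHP, |f x|

/-- `L²(Π)` norm. -/
def normL2 (f : ℝ × ℝ → ℝ) : ℝ := (∫ x in UHP, (f x) ^ 2) ^ ((1 : ℝ) / 2)

/-- `L^s(Π)` norm. -/
def normLs (s : ℝ) (f : ℝ × ℝ → ℝ) : ℝ := (∫ x in UHP, |f x| ^ s) ^ (1 / s)

/-- Nonnegative member of `L¹(Π) ∩ L²(Π)`. -/
def NonnegL1L2 (ω : ℝ × ℝ → ℝ) : Prop :=
  (∀ x ∈ UHP, 0 ≤ ω x) ∧ IntegrableOn ω UHP ∧ IntegrableOn (fun x => (ω x) ^ 2) UHP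

/-- Steiner symmetry in the `x₁` variable. -/
def SteinerSym (f : ℝ × ℝ → ℝ) : Prop :=
  (∀ x : ℝ × ℝ, f (-x.1, x.2) = f x) ∧
  ∀ x₂ : ℝ, 0 < x₂ → AntitoneOn (fun x₁ => f (x₁, x₂)) (Set.Ioi (0 : ℝ))

/-- The admissible class `𝒜_{μ,ν}`. -/
def InAdm (μ ν : ℝ) (ω : ℝ × ℝ → ℝ) : Prop :=
  (∀ x ∈ UHP, 0 ≤ ω x) ∧ IntegrableOn ω UHP ∧ IntegrableOn (fun x => (ω x) ^ 2) UHP ∧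
  IntegrableOn (fun x => x.2 * ω x) UHP ∧
  impulse ω = μ ∧ (∫ x in UHP, ω x) ≤ ν

/-- The energy functional `ℰ_λ(ω) = E(ω) − (1/(2λ)) ∫_Π ω²`. -/
def Efun (lam : ℝ) (ω : ℝ × ℝ → ℝ) : ℝ :=
  kineticE ω - (1 / (2 * lam)) * ∫ x in UHP, (ω x) ^ 2

/-- The supremum `S_{μ,ν,λ} = sup_{ω ∈ 𝒜_{μ,ν}} ℰ_λ(ω)`. -/
def Sval (lam μ ν : ℝ) : ℝ := sSup {s | ∃ ω, InAdm μ ν ω ∧ s = Efun lam ω}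

/-- `ω` is a maximizer, i.e. `ω ∈ Σ_{μ,ν,λ}`. -/
def IsMaximizer (lam μ ν : ℝ) (ω : ℝ × ℝ → ℝ) : Prop :=
  InAdm μ ν ω ∧ Efun lam ω = Sval lam μ ν

/-- Bessel function of the first kind of order one. -/
def J1 (r : ℝ) : ℝ :=
  ∑' k : ℕ, ((-1 : ℝ) ^ k / ((Nat.factorial k : ℝ) * (Nat.factorial (k + 1) : ℝ))) *
    (r / 2) ^ (2 * k + 1)

/-- Modified Bessel function of the second kind of order one. -/
def K1 (r : ℝ) : ℝ := ∫ t in Set.Ioi (0 : ℝ), Real.exp (-(r * Real.cosh t)) * Real.cosh t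

/-- The set of `t > 0` with `J₁(√(λ−1) t) ≠ 0` solving the transcendental equation
`t (K₁'(t)/K₁(t) + (λ−1)^{-1/2} J₁'(√(λ−1)t)/J₁(√(λ−1)t)) = λ/(λ−1)`. -/
def aSet (lam : ℝ) : Set ℝ :=
  {t | 0 < t ∧ J1 (Real.sqrt (lam - 1) * t) ≠ 0 ∧
    t * (deriv K1 t / K1 t +
      (1 / Real.sqrt (lam - 1)) *
        (deriv J1 (Real.sqrt (lam - 1) * t) / J1 (Real.sqrt (lam - 1) * t))) = lam / (lam - 1)}

/-- The smallest positive solution `a = a(λ)`. -/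
def aLam (lam : ℝ) : ℝ := sInf (aSet lam)

/-- The stream function `Ψ_L^{λ,W}` of the Lamb dipole, written in polar coordinates
`x₁ = r cos θ`, `x₂ = r sin θ` (so that `sin θ = x₂ / r`). -/
def PsiL (lam W : ℝ) (x : ℝ × ℝ) : ℝ :=
  if rad x ≤ aLam lam then
    ((-(W * aLam lam / (lam - 1)) / J1 (Real.sqrt (lam - 1) * aLam lam)) *
        J1 (Real.sqrt (lam - 1) * rad x) + (W * lam / (lam - 1)) * rad x) * (x.2 / rad x)
  else (W * aLam lam / K1 (aLam lam)) * K1 (rad x) * (x.2 / rad x)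

/-- The Lamb dipole `ω_L^{λ,W} = λ (Ψ_L^{λ,W} − W x₂)₊` restricted to `Π`. -/
def omegaL (lam W : ℝ) (x : ℝ × ℝ) : ℝ :=
  if 0 < x.2 then lam * max (PsiL lam W x - W * x.2) 0 else 0

/-- `ϱ(λ) = (∫_Π ω_L^{λ,1} dx) / I(ω_L^{λ,1})`. -/
def varrho (lam : ℝ) : ℝ := (∫ x in UHP, omegaL lam 1 x) / impulse (omegaL lam 1)

/-- The Laplacian on `ℝ²`, written coordinatewise. -/
def lap (ψ : ℝ × ℝ → ℝ) (x : ℝ × ℝ) : ℝ :=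
  deriv (deriv fun t => ψ (t, x.2)) x.1 + deriv (deriv fun t => ψ (x.1, t)) x.2

/-- Distance (in `L¹ ∩ L²` plus weighted `L¹`) from `ζ` to a set of functions `S`. -/
def distToSet (S : Set ((ℝ × ℝ) → ℝ)) (ζ : (ℝ × ℝ) → ℝ) : ℝ :=
  sInf {d | ∃ ω ∈ S, d = normL1 (fun x => ζ x - ω x) + normL2 (fun x => ζ x - ω x) +
    normL1 (fun x => x.2 * (ζ x - ω x))}

end

lemma rad_nonneg (z : ℝ × ℝ) : 0 ≤ rad z := Real.sqrt_nonneg _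

lemma rad_cont : Continuous rad := by unfold rad; fun_prop

lemma abs_fst_le_rad (z : ℝ × ℝ) : |z.1| ≤ rad z :=
  Real.abs_le_sqrt (by nlinarith [sq_nonneg z.2])

lemma abs_snd_le_rad (z : ℝ × ℝ) : |z.2| ≤ rad z :=
  Real.abs_le_sqrt (by nlinarith [sq_nonneg z.1])

lemma rad_le_abs_add (z : ℝ × ℝ) : rad z ≤ |z.1| + |z.2| := by
  unfold rad
  apply Real.sqrt_le_iff.2
  refine ⟨by positivity, ?_⟩
  nlinarith [sq_abs z.1, sq_abs z.2, mul_nonneg (abs_nonneg z.1) (abs_nonneg z.2)]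

/-- The majorant of the kernel. -/
noncomputable def kmaj (z : ℝ × ℝ) : ℝ := Real.sqrt ((rad z)⁻¹) * Real.exp (-rad z)

lemma kmaj_nonneg (z : ℝ × ℝ) : 0 ≤ kmaj z := by unfold kmaj; positivity

lemma kmaj_meas : Measurable kmaj := by
  unfold kmaj
  have := rad_cont.measurable
  fun_prop

lemma cosh_lower (t : ℝ) (ht : 0 ≤ t) : 1 + t ^ 2 / 2 ≤ Real.cosh t := by
  have h1 : Real.cosh t = 1 + 2 * Real.sinh (t / 2) ^ 2 := by
    have := Real.cosh_two_mul (t / 2)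
    have h2 := Real.cosh_sq (t / 2)
    rw [show 2 * (t / 2) = t by ring] at this
    linarith
  have h3 : t / 2 ≤ Real.sinh (t / 2) := Real.self_le_sinh_iff.2 (by linarith)
  have : (t / 2) ^ 2 ≤ Real.sinh (t / 2) ^ 2 := by gcongr
  rw [h1]; linarith

lemma K0_nonneg (r : ℝ) : 0 ≤ K0 r := by
  unfold K0
  exact integral_nonneg fun t => (Real.exp_pos _).le

lemma K0_zero : K0 0 = 0 := by
  unfold K0
  simp [Measure.real]

lemma K0_le (r : ℝ) (hr : 0 ≤ r) : K0 r ≤ 2 * (Real.sqrt (r⁻¹) * Real.exp (-r)) := by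
  rcases hr.eq_or_lt with rfl | hr
  · rw [K0_zero]; positivity
  have hint : Integrable (fun t : ℝ => Real.exp (-r) * Real.exp (-(r / 2) * t ^ 2)) :=
    (integrable_exp_neg_mul_sq (by positivity : 0 < r / 2)).const_mul _
  have h1 : K0 r ≤ ∫ t in Set.Ioi (0 : ℝ), Real.exp (-r) * Real.exp (-(r / 2) * t ^ 2) := by
    unfold K0
    apply integral_mono_of_nonneg
    · exact Eventually.of_forall fun t => (Real.exp_pos _).le
    · exact hint.integrableOn
    · refine (ae_restrict_iff' measurableSet_Ioi).2 (Eventually.of_forall fun t ht => ?_)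
      simp only
      rw [← Real.exp_add]
      apply Real.exp_le_exp.2
      have := mul_le_mul_of_nonneg_left (cosh_lower t (le_of_lt ht)) hr.le
      linarith
  rw [integral_const_mul, integral_gaussian_Ioi] at h1
  have h2 : Real.sqrt (π / (r / 2)) ≤ 4 * Real.sqrt (r⁻¹) := by
    rw [show (4 : ℝ) = Real.sqrt (4 ^ 2) by simp, ← Real.sqrt_mul (by positivity)]
    apply Real.sqrt_le_sqrt
    rw [show π / (r / 2) = (2 * π) * r⁻¹ by field_simp]
    have := Real.pi_le_four
    gcongr
    linarith
  nlinarith [Real.exp_pos (-r)]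

lemma Gker_nonneg (x y : ℝ × ℝ) : 0 ≤ Gker x y := by
  unfold Gker
  have := K0_nonneg (rad (x - y))
  positivity

lemma Gker_le (x y : ℝ × ℝ) : Gker x y ≤ kmaj (x - y) := by
  unfold Gker
  have h := K0_le (rad (x - y)) (rad_nonneg _)
  have hk := kmaj_nonneg (x - y)
  change _ ≤ 2 * kmaj (x - y) at h
  have h3 : 1 / (2 * π) ≤ 1 / 2 := by
    apply one_div_le_one_div_of_le (by norm_num)
    linarith [Real.pi_gt_three]
  calc _ ≤ 1 / 2 * (2 * kmaj (x - y)) := by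
        apply mul_le_mul h3 h (K0_nonneg _) (by norm_num)
    _ = _ := by ring

lemma f_int : Integrable (fun s : ℝ => Real.exp (-|s|) * |s| ^ (-(1 / 2) : ℝ)) := by
  have h := Real.GammaIntegral_convergent (s := 1 / 2) (by norm_num)
  rw [show (1 / 2 - 1 : ℝ) = -(1 / 2) by norm_num] at h
  have h1 := h.integrable_indicator measurableSet_Ioi
  refine (h1.add h1.comp_neg).congr ?_
  filter_upwards [volume.ae_ne (0 : ℝ)] with s hs
  rcases lt_or_gt_of_ne hs with h0 | h0
  · simp [Set.indicator, h0, abs_of_neg h0, h0.le, h0.not_gt]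
  · simp [Set.indicator, h0, abs_of_pos h0, h0.le, h0.not_gt]

lemma kmaj_sq_int : Integrable (fun z => kmaj z ^ 2) := by
  have hI : Integrable (fun z : ℝ × ℝ => (Real.exp (-|z.1|) * |z.1| ^ (-(1 / 2) : ℝ)) *
      (Real.exp (-|z.2|) * |z.2| ^ (-(1 / 2) : ℝ))) := f_int.mul_prod f_int
  refine hI.mono' (kmaj_meas.pow_const 2).aestronglyMeasurable ?_
  have e1 : ∀ᵐ z : ℝ × ℝ, z.1 ≠ 0 :=
    Measure.quasiMeasurePreserving_fst.ae (volume.ae_ne (0 : ℝ))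
  have e2 : ∀ᵐ z : ℝ × ℝ, z.2 ≠ 0 :=
    Measure.quasiMeasurePreserving_snd.ae (volume.ae_ne (0 : ℝ))
  filter_upwards [e1, e2] with z h1 h2
  have p1 : 0 < |z.1| := abs_pos.2 h1
  have p2 : 0 < |z.2| := abs_pos.2 h2
  have a1 := abs_fst_le_rad z
  have a2 := abs_snd_le_rad z
  have hr : 0 < rad z := lt_of_lt_of_le p1 a1
  rw [Real.norm_of_nonneg (by positivity)]
  have k2 : kmaj z ^ 2 = (rad z)⁻¹ * Real.exp (-rad z + -rad z) := by
    unfold kmaj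
    rw [mul_pow, Real.sq_sqrt (by positivity), Real.exp_add]; ring
  rw [k2]
  have e : (Real.exp (-|z.1|) * |z.1| ^ (-(1 / 2) : ℝ)) *
      (Real.exp (-|z.2|) * |z.2| ^ (-(1 / 2) : ℝ)) =
      (|z.1| * |z.2|) ^ (-(1 / 2) : ℝ) * Real.exp (-|z.1| + -|z.2|) := by
    rw [Real.mul_rpow p1.le p2.le, Real.exp_add]; ring
  rw [e]
  apply mul_le_mul _ (Real.exp_le_exp.2 (by linarith)) (Real.exp_pos _).le (by positivity)
  rw [Real.rpow_neg (by positivity), ← Real.sqrt_eq_rpow]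
  apply inv_anti₀ (by positivity)
  apply Real.sqrt_le_iff.2
  refine ⟨hr.le, ?_⟩
  nlinarith

lemma kmaj_tendsto : Tendsto kmaj (comap rad atTop) (nhds 0) := by
  have h : Tendsto (fun r : ℝ => Real.sqrt (r⁻¹) * Real.exp (-r)) atTop (nhds 0) := by
    have h1 : Tendsto (fun r : ℝ => Real.sqrt (r⁻¹)) atTop (nhds 0) := by
      have := (Real.continuous_sqrt.tendsto 0).comp (tendsto_inv_atTop_zero (𝕜 := ℝ))
      rw [Real.sqrt_zero] at this
      exact this
    simpa using h1.mul Real.tendsto_exp_neg_atTop_nhds_zero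
  exact h.comp tendsto_comap

lemma rad_sub_ge (x y : ℝ × ℝ) : rad x / 2 - (|y.1| + |y.2|) ≤ rad (x - y) := by
  have h1 := abs_fst_le_rad (x - y)
  have h2 := abs_snd_le_rad (x - y)
  have h3 := rad_le_abs_add x
  have h4 : |x.1| ≤ |x.1 - y.1| + |y.1| := by
    simpa using abs_add_le (x.1 - y.1) y.1
  have h5 : |x.2| ≤ |x.2 - y.2| + |y.2| := by
    simpa using abs_add_le (x.2 - y.2) y.2
  simp only [Prod.fst_sub, Prod.snd_sub] at h1 h2
  linarith [abs_nonneg y.1, abs_nonneg y.2]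

lemma rad_refl (x : ℝ × ℝ) : rad (reflPt x) = rad x := by simp [rad, reflPt]

lemma tendsto_shift (y : ℝ × ℝ) :
    Tendsto (fun x => x - y) (comap rad atTop) (comap rad atTop) := by
  rw [tendsto_comap_iff]
  refine tendsto_atTop_mono (fun x => rad_sub_ge x y) ?_
  apply tendsto_atTop_add_const_right
  exact (tendsto_comap (f := rad)).atTop_div_const (by norm_num)

lemma tendsto_refl : Tendsto reflPt (comap rad atTop) (comap rad atTop) := by
  rw [tendsto_comap_iff]
  refine (tendsto_comap (f := rad)).congr fun x => (rad_refl x).symm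

lemma GUHP_abs_le (x y : ℝ × ℝ) : |GUHP x y| ≤ kmaj (x - y) + kmaj (reflPt x - y) := by
  unfold GUHP
  have a := Gker_nonneg x y
  have b := Gker_nonneg (reflPt x) y
  have c := Gker_le x y
  have d := Gker_le (reflPt x) y
  rw [abs_le]; constructor <;> linarith

lemma UHP_meas : MeasurableSet UHP := measurableSet_lt measurable_const measurable_snd

/-- `𝒢ω(x) → 0` as `|x| → ∞`, `x ∈ Π`. -/
theorem stmt2 (ω : ℝ × ℝ → ℝ) (hω : NonnegL1L2 ω) :
    ∀ ε : ℝ, 0 < ε → ∃ R : ℝ, ∀ x ∈ UHP, R ≤ rad x → |Gop ω x| ≤ ε := by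
  obtain ⟨h0, h1, h2⟩ := hω
  intro ε hε
  set A : ℝ := ∫ z, kmaj z ^ 2 with hA
  have hA0 : 0 ≤ A := integral_nonneg fun z => sq_nonneg _
  -- the parameter in the weighted Young inequality
  obtain ⟨δ, hδ, hδA⟩ : ∃ δ : ℝ, 0 < δ ∧ δ * (A + A) ≤ ε / 2 := by
    refine ⟨ε / 2 / (A + A + 1), by positivity, ?_⟩
    rw [div_mul_eq_mul_div, div_le_iff₀ (by positivity)]
    nlinarith
  let κ : ℝ × ℝ → ℝ × ℝ → ℝ := fun x y => kmaj (x - y) + kmaj (reflPt x - y)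
  have κ0 : ∀ x y, 0 ≤ κ x y := fun x y => add_nonneg (kmaj_nonneg _) (kmaj_nonneg _)
  have κm : ∀ x, Measurable (κ x) := fun x =>
    (kmaj_meas.comp (measurable_const.sub measurable_id)).add
      (kmaj_meas.comp (measurable_const.sub measurable_id))
  let u : ℝ × ℝ → ℝ × ℝ → ℝ := fun x y => min (κ x y * ω y) (ω y ^ 2 / (2 * δ))
  have um : ∀ x, AEStronglyMeasurable (u x) (volume.restrict UHP) := fun x =>
    ((κm x).aestronglyMeasurable.mul h1.aestronglyMeasurable).inf
      (h2.div_const _).aestronglyMeasurable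
  have ubound : ∀ x, ∀ᵐ y ∂(volume.restrict UHP), ‖u x y‖ ≤ ω y ^ 2 / (2 * δ) := by
    intro x
    refine (ae_restrict_iff' UHP_meas).2 (Eventually.of_forall fun y hy => ?_)
    rw [Real.norm_of_nonneg (le_min (mul_nonneg (κ0 x y) (h0 y hy)) (by positivity))]
    exact min_le_right _ _
  have ui : ∀ x, Integrable (u x) (volume.restrict UHP) := fun x =>
    Integrable.mono' (h2.div_const _) (um x) (ubound x)
  have hlim : Tendsto (fun x => ∫ y in UHP, u x y) (comap rad atTop) (nhds 0) := by
    have := tendsto_integral_filter_of_dominated_convergence (μ := volume.restrict UHP)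
      (l := comap rad atTop) (F := u) (f := fun _ => 0) (fun y => ω y ^ 2 / (2 * δ))
      (Eventually.of_forall um) (Eventually.of_forall ubound) (h2.div_const _) ?_
    · simpa using this
    · refine Eventually.of_forall fun y => ?_
      have ht : Tendsto (fun x => κ x y) (comap rad atTop) (nhds 0) := by
        have a := kmaj_tendsto.comp (tendsto_shift y)
        have b := kmaj_tendsto.comp ((tendsto_shift y).comp tendsto_refl)
        simpa using a.add b
      have hc : (0 : ℝ) = min (0 * ω y) (ω y ^ 2 / (2 * δ)) := by
        rw [zero_mul, min_eq_left (by positivity)]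
      rw [hc]
      exact (ht.mul_const _).min tendsto_const_nhds
  have hev := hlim.eventually (gt_mem_nhds (half_pos hε))
  rw [eventually_comap] at hev
  obtain ⟨R, hR⟩ := eventually_atTop.1 hev
  refine ⟨R, fun x hx hxR => ?_⟩
  have hux := hR (rad x) hxR x rfl
  have i1 : ∀ w : ℝ × ℝ, Integrable (fun y => kmaj (w - y) ^ 2) := fun w =>
    kmaj_sq_int.comp_sub_left w
  have e1 : ∀ w : ℝ × ℝ, ∫ y in UHP, kmaj (w - y) ^ 2 ≤ A := by
    intro w
    refine (setIntegral_le_integral (i1 w) (Eventually.of_forall fun y => sq_nonneg _)).trans ?_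
    rw [integral_sub_left_eq_self (fun z => kmaj z ^ 2) volume w]
  have ik : Integrable (fun y => δ * (kmaj (x - y) ^ 2 + kmaj (reflPt x - y) ^ 2))
      (volume.restrict UHP) :=
    (((i1 x).add (i1 (reflPt x))).const_mul δ).integrableOn
  have main : ‖Gop ω x‖ ≤
      ∫ y in UHP, (δ * (kmaj (x - y) ^ 2 + kmaj (reflPt x - y) ^ 2) + u x y) := by
    unfold Gop
    apply norm_integral_le_of_norm_le (ik.add (ui x))
    refine (ae_restrict_iff' UHP_meas).2 (Eventually.of_forall fun y hy => ?_)
    have w0 := h0 y hy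
    have hk : ‖GUHP x y * ω y‖ ≤ κ x y * ω y := by
      rw [norm_mul, Real.norm_of_nonneg w0]
      exact mul_le_mul_of_nonneg_right (GUHP_abs_le x y) w0
    refine hk.trans ?_
    change κ x y * ω y ≤ δ * (kmaj (x - y) ^ 2 + kmaj (reflPt x - y) ^ 2)
      + min (κ x y * ω y) (ω y ^ 2 / (2 * δ))
    have hp : 0 ≤ δ * (kmaj (x - y) ^ 2 + kmaj (reflPt x - y) ^ 2) := by positivity
    rcases min_choice (κ x y * ω y) (ω y ^ 2 / (2 * δ)) with hm | hm
    · rw [hm]; linarith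
    · rw [hm]
      have hsq : κ x y ^ 2 ≤ 2 * (kmaj (x - y) ^ 2 + kmaj (reflPt x - y) ^ 2) := by
        change (kmaj (x - y) + kmaj (reflPt x - y)) ^ 2 ≤ _
        nlinarith [sq_nonneg (kmaj (x - y) - kmaj (reflPt x - y))]
      have hy2 : κ x y * ω y ≤ δ / 2 * κ x y ^ 2 + ω y ^ 2 / (2 * δ) := by
        have : δ / 2 * κ x y ^ 2 + ω y ^ 2 / (2 * δ) - κ x y * ω y
            = (δ * κ x y - ω y) ^ 2 / (2 * δ) := by
          field_simp; ring
        have h' : 0 ≤ (δ * κ x y - ω y) ^ 2 / (2 * δ) := by positivity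
        linarith
      nlinarith
  rw [integral_add ik (ui x), integral_const_mul,
    integral_add (i1 x).integrableOn (i1 (reflPt x)).integrableOn] at main
  have hb : δ * ((∫ y in UHP, kmaj (x - y) ^ 2) + ∫ y in UHP, kmaj (reflPt x - y) ^ 2)
      ≤ δ * (A + A) := by
    apply mul_le_mul_of_nonneg_left (add_le_add (e1 _) (e1 _)) hδ.le
  rw [← Real.norm_eq_abs]
  linarith
end

section
/- Let λ > 1, μ > 0 and ν > 0 satisfy μϱ(λ) ≤ ν. Then 0 < S_{μ,ν,λ} < ∞; moreover there is an absolute constant C > 0 such that S_{μ,ν,λ} ≤ C λ^{1/3} ν². -/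
open MeasureTheory Real Filter

namespace LambAux

lemma ofReal_integral_le {α : Type*} [MeasurableSpace α] (m : Measure α) (f : α → ℝ) :
    ENNReal.ofReal (∫ x, f x ∂m) ≤ ∫⁻ x, ENNReal.ofReal (f x) ∂m := by
  by_cases hf : Integrable f m
  · rw [integral_eq_lintegral_pos_part_sub_lintegral_neg_part hf]
    refine le_trans (ENNReal.ofReal_le_ofReal (sub_le_self _ ENNReal.toReal_nonneg)) ?_
    exact ENNReal.ofReal_toReal_le
  · rw [integral_undef hf]; simp

lemma lintegral_sech (T : ℝ) :
    ∫⁻ t in Set.Ioi T, ENNReal.ofReal (1 / Real.cosh t ^ 2)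
      = ENNReal.ofReal (2 / (Real.exp (2 * T) + 1)) := by
  have hd : ∀ x ∈ Set.Ici T,
      HasDerivAt (fun t : ℝ => -(2 / (Real.exp (2 * t) + 1))) (1 / Real.cosh x ^ 2) x := by
    intro x _
    have h1 : HasDerivAt (fun t : ℝ => Real.exp (2 * t) + 1) (Real.exp (2 * x) * 2) x := by
      have := ((hasDerivAt_id x).const_mul 2).exp.add_const (1:ℝ)
      simpa using this
    have hp : Real.exp (2 * x) + 1 ≠ 0 := by positivity
    have h2 := ((hasDerivAt_const x (2:ℝ)).div h1 hp).neg
    refine h2.congr_deriv ?_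
    symm
    have e : Real.exp (2 * x) = Real.exp x ^ 2 := by rw [← Real.exp_nat_mul]; norm_num
    rw [Real.cosh_eq, Real.exp_neg, e]
    have := Real.exp_pos x
    field_simp
    ring
  have hn : ∀ x ∈ Set.Ioi T, 0 ≤ 1 / Real.cosh x ^ 2 := fun x _ => by positivity
  have hl : Tendsto (fun t : ℝ => -(2 / (Real.exp (2 * t) + 1))) atTop (nhds 0) := by
    have h1 : Tendsto (fun t : ℝ => Real.exp (2 * t) + 1) atTop atTop := by
      apply tendsto_atTop_add_const_right
      exact Real.tendsto_exp_atTop.comp (tendsto_id.const_mul_atTop (by norm_num))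
    simpa using (h1.const_div_atTop 2).neg
  have hi := integrableOn_Ioi_deriv_of_nonneg' hd hn hl
  rw [← ofReal_integral_eq_lintegral_ofReal hi, integral_Ioi_of_hasDerivAt_of_nonneg' hd hn hl]
  · simp
  · exact Eventually.of_forall fun x => by positivity

lemma lintegral_exp_rad (c : ℝ) (hc : 0 < c) :
    ∫⁻ z : ℝ × ℝ, ENNReal.ofReal (Real.exp (-(rad z * c))) = ENNReal.ofReal (2 * π / c ^ 2) := by
  rw [← lintegral_comp_polarCoord_symm, polarCoord_target]
  have h1 : ∀ p ∈ Set.Ioi (0:ℝ) ×ˢ Set.Ioo (-π) π,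
      ENNReal.ofReal p.1 • ENNReal.ofReal (Real.exp (-(rad (polarCoord.symm p) * c)))
      = ENNReal.ofReal (p.1 * Real.exp (-(c * p.1))) * 1 := by
    rintro ⟨r, θ⟩ ⟨hr, -⟩
    have hr : 0 < r := hr
    have : rad (polarCoord.symm (r, θ)) = r := by
      rw [polarCoord_symm_apply, rad]
      have : (r * Real.cos θ) ^ 2 + (r * Real.sin θ) ^ 2 = r ^ 2 := by
        linear_combination r ^ 2 * Real.cos_sq_add_sin_sq θ
      simp only [this]
      exact Real.sqrt_sq hr.le
    rw [this, smul_eq_mul, ← ENNReal.ofReal_mul hr.le, mul_one, mul_comm c]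
  rw [setLIntegral_congr_fun (measurableSet_Ioi.prod measurableSet_Ioo) h1,
    Measure.volume_eq_prod, ← Measure.prod_restrict,
    lintegral_prod_mul (f := fun r : ℝ => ENNReal.ofReal (r * Real.exp (-(c * r))))
      (g := fun _ : ℝ => (1 : ENNReal)) (by fun_prop) (by fun_prop)]
  have h2 := Real.integral_rpow_mul_exp_neg_mul_Ioi (a := 2) (r := c) (by norm_num) hc
  have h3 : ∫ t in Set.Ioi (0:ℝ), t * Real.exp (-(c * t)) = 1 / c ^ 2 := by
    have : ∀ t : ℝ, t ^ ((2:ℝ) - 1) = t := fun t => by norm_num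
    simp only [this] at h2
    rw [h2, Real.Gamma_two]
    norm_num
  have h4 : IntegrableOn (fun t : ℝ => t * Real.exp (-(c * t))) (Set.Ioi 0) := by
    by_contra h
    have := integral_undef h
    rw [h3] at this
    have : 0 < 1 / c ^ 2 := by positivity
    linarith
  rw [← ofReal_integral_eq_lintegral_ofReal h4, h3]
  · simp only [lintegral_one, Measure.restrict_apply MeasurableSet.univ, Set.univ_inter,
      Real.volume_Ioo]
    rw [← ENNReal.ofReal_mul (by positivity)]
    congr 1; ring
  · filter_upwards [ae_restrict_mem measurableSet_Ioi] with t ht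
    have : (0:ℝ) < t := ht
    positivity

lemma measurable_rad : Measurable rad := by unfold rad; fun_prop

lemma lintegral_kernel (T : ℝ) :
    ∫⁻ z : ℝ × ℝ, ∫⁻ t in Set.Ioi T, ENNReal.ofReal (Real.exp (-(rad z * Real.cosh t)))
      = ENNReal.ofReal (2 * π) * ENNReal.ofReal (2 / (Real.exp (2 * T) + 1)) := by
  have hr := measurable_rad
  rw [lintegral_lintegral_swap]
  · rw [← lintegral_sech, ← lintegral_const_mul _ (by fun_prop)]
    refine lintegral_congr fun t => ?_
    rw [lintegral_exp_rad _ (Real.cosh_pos t), ← ENNReal.ofReal_mul (by positivity)]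
    congr 1; ring
  · apply Measurable.aemeasurable
    unfold Function.uncurry
    fun_prop

lemma rad_nonneg (z : ℝ × ℝ) : 0 ≤ rad z := Real.sqrt_nonneg _

lemma K0_nonneg (r : ℝ) : 0 ≤ K0 r := integral_nonneg fun _ => (Real.exp_pos _).le

lemma le_cosh (t : ℝ) : t ≤ Real.cosh t := by
  rcases le_total 0 t with h | h
  · exact (Real.self_le_sinh_iff.2 h).trans (Real.sinh_lt_cosh t).le
  · exact h.trans (Real.cosh_pos t).le

lemma exp_bound {r : ℝ} (hr : 0 < r) (t : ℝ) :
    Real.exp (-(r * Real.cosh t)) ≤ Real.exp ((-r) * t) := by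
  apply Real.exp_le_exp.2
  nlinarith [mul_le_mul_of_nonneg_left (le_cosh t) hr.le]

lemma K0_integrable {r : ℝ} (hr : 0 < r) :
    IntegrableOn (fun t => Real.exp (-(r * Real.cosh t))) (Set.Ioi 0) := by
  refine (integrableOn_exp_mul_Ioi (a := -r) (by linarith) 0).mono' (by fun_prop) ?_
  refine Eventually.of_forall fun t => ?_
  rw [Real.norm_eq_abs, abs_of_pos (Real.exp_pos _)]
  exact exp_bound hr t

lemma K0_le {r : ℝ} (hr : 0 < r) : K0 r ≤ 1 / r := by
  have h := integral_exp_mul_Ioi (a := -r) (by linarith) 0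
  have : K0 r ≤ ∫ t in Set.Ioi (0:ℝ), Real.exp ((-r) * t) :=
    integral_mono (K0_integrable hr) (integrableOn_exp_mul_Ioi (a := -r) (by linarith) 0)
      (fun t => exp_bound hr t)
  rw [h] at this
  refine this.trans (le_of_eq ?_)
  simp

lemma ofReal_K0 {r : ℝ} (hr : 0 < r) :
    ENNReal.ofReal (K0 r) = ∫⁻ t in Set.Ioi (0:ℝ), ENNReal.ofReal (Real.exp (-(r * Real.cosh t))) :=
  ofReal_integral_eq_lintegral_ofReal (K0_integrable hr)
    (Eventually.of_forall fun _ => (Real.exp_pos _).le)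

lemma measurable_K0 : Measurable K0 := by
  have : StronglyMeasurable (fun p : ℝ × ℝ => Real.exp (-(p.1 * Real.cosh p.2))) := by
    apply Measurable.stronglyMeasurable; fun_prop
  exact (this.integral_prod_right' (ν := volume.restrict (Set.Ioi (0:ℝ)))).measurable

/-- the kernel as a function of the difference -/
noncomputable def gk (z : ℝ × ℝ) : ℝ := (1 / (2 * π)) * K0 (rad z)

lemma gk_nonneg (z : ℝ × ℝ) : 0 ≤ gk z := mul_nonneg (by positivity) (K0_nonneg _)

lemma measurable_gk : Measurable gk := by
  have := measurable_K0.comp measurable_rad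
  exact this.const_mul _

lemma rad_pos {z : ℝ × ℝ} (hz : z ≠ 0) : 0 < rad z := by
  apply Real.sqrt_pos.2
  by_contra h
  apply hz
  have h1 : z.1 = 0 := by nlinarith [sq_nonneg z.1, sq_nonneg z.2]
  have h2 : z.2 = 0 := by nlinarith [sq_nonneg z.1, sq_nonneg z.2]
  exact Prod.ext h1 h2

lemma lintegral_gk : ∫⁻ z, ENNReal.ofReal (gk z) = 1 := by
  have h := lintegral_kernel 0
  have h1 : ∫⁻ z, ENNReal.ofReal (gk z) = ∫⁻ z : ℝ × ℝ, ENNReal.ofReal (1 / (2 * π)) *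
      ∫⁻ t in Set.Ioi (0:ℝ), ENNReal.ofReal (Real.exp (-(rad z * Real.cosh t))) := by
    apply lintegral_congr_ae
    have : ∀ᵐ z : ℝ × ℝ, z ≠ 0 := by
      simp [ae_iff]
    filter_upwards [this] with z hz
    rw [gk, ENNReal.ofReal_mul (by positivity), ofReal_K0 (rad_pos hz)]
  rw [h1, lintegral_const_mul' _ _ ENNReal.ofReal_ne_top, h, ← ENNReal.ofReal_mul (by positivity),
    ← ENNReal.ofReal_mul (by positivity)]
  have := Real.pi_pos
  rw [← ENNReal.ofReal_one]
  congr 1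
  norm_num
  field_simp

lemma integrable_gk : Integrable gk := by
  refine ⟨measurable_gk.aestronglyMeasurable, ?_⟩
  rw [hasFiniteIntegral_iff_ofReal (Eventually.of_forall gk_nonneg), lintegral_gk]
  simp

lemma integral_gk : ∫ z, gk z = 1 := by
  rw [integral_eq_lintegral_of_nonneg_ae (Eventually.of_forall gk_nonneg)
    measurable_gk.aestronglyMeasurable, lintegral_gk]
  simp

/-- the tail part of the kernel -/
noncomputable def k2 (T : ℝ) (z : ℝ × ℝ) : ENNReal :=
  ENNReal.ofReal (1 / (2 * π)) *
    ∫⁻ t in Set.Ioi T, ENNReal.ofReal (Real.exp (-(rad z * Real.cosh t)))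

lemma measurable_k2 (T : ℝ) : Measurable (k2 T) := by
  have hr := measurable_rad
  refine Measurable.const_mul ?_ _
  apply Measurable.lintegral_prod_right'
    (f := fun p : (ℝ × ℝ) × ℝ => ENNReal.ofReal (Real.exp (-(rad p.1 * Real.cosh p.2))))
  fun_prop

lemma lintegral_k2 (T : ℝ) : ∫⁻ z, k2 T z = ENNReal.ofReal (2 / (Real.exp (2 * T) + 1)) := by
  unfold k2
  rw [lintegral_const_mul' _ _ ENNReal.ofReal_ne_top, lintegral_kernel, ← mul_assoc,
    ← ENNReal.ofReal_mul (by positivity)]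
  have := Real.pi_pos
  rw [show 1 / (2 * π) * (2 * π) = 1 by field_simp]
  simp

lemma gk_le (T : ℝ) (hT : 0 ≤ T) (z : ℝ × ℝ) :
    ENNReal.ofReal (gk z) ≤ ENNReal.ofReal (T / (2 * π)) + k2 T z := by
  have h1 : ENNReal.ofReal (K0 (rad z)) ≤ ENNReal.ofReal T +
      ∫⁻ t in Set.Ioi T, ENNReal.ofReal (Real.exp (-(rad z * Real.cosh t))) := by
    refine (ofReal_integral_le _ _).trans ?_
    rw [← Set.Ioc_union_Ioi_eq_Ioi hT]
    refine (lintegral_union_le _ _ _).trans ?_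
    gcongr
    calc _ ≤ ∫⁻ t in Set.Ioc (0:ℝ) T, 1 := by
          refine lintegral_mono fun t => ?_
          rw [← ENNReal.ofReal_one]
          apply ENNReal.ofReal_le_ofReal
          apply Real.exp_le_one_iff.2
          have := mul_nonneg (rad_nonneg z) (Real.cosh_pos t).le
          linarith
      _ = _ := by simp
  rw [gk, ENNReal.ofReal_mul (by positivity)]
  calc _ ≤ ENNReal.ofReal (1 / (2 * π)) * _ := mul_le_mul_right h1 _
    _ = _ := by
      rw [mul_add, ← ENNReal.ofReal_mul (by positivity), k2]
      congr 2; ring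

lemma two_mul_le (a b : ENNReal) (ha : a ≠ ⊤) (hb : b ≠ ⊤) : 2 * (a * b) ≤ a ^ 2 + b ^ 2 := by
  lift a to NNReal using ha
  lift b to NNReal using hb
  norm_cast
  rw [← mul_assoc]
  exact two_mul_le_add_sq a b

lemma young (m : Measure (ℝ × ℝ)) [SFinite m] (hm : m ≤ volume) (w k : ℝ × ℝ → ENNReal)
    (hw : AEMeasurable w m) (hk : Measurable k) (hwt : ∀ x, w x ≠ ⊤) :
    ∫⁻ x, w x * ∫⁻ y, k (x - y) * w y ∂m ∂m ≤ (∫⁻ z, k z) * ∫⁻ x, w x ^ 2 ∂m := by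
  have hkm : Measurable (fun p : (ℝ × ℝ) × (ℝ × ℝ) => k (p.1 - p.2)) := by fun_prop
  have A : ∫⁻ x, ∫⁻ y, k (x - y) * w x ^ 2 ∂m ∂m ≤ (∫⁻ z, k z) * ∫⁻ x, w x ^ 2 ∂m := by
    rw [← lintegral_const_mul'' _ (by fun_prop)]
    refine lintegral_mono fun x => ?_
    rw [lintegral_mul_const _ (by fun_prop)]
    refine mul_le_mul_left ?_ _
    rw [← lintegral_sub_left_eq_self k x]
    exact lintegral_mono' hm le_rfl
  have B : ∫⁻ x, ∫⁻ y, k (x - y) * w y ^ 2 ∂m ∂m ≤ (∫⁻ z, k z) * ∫⁻ x, w x ^ 2 ∂m := by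
    rw [lintegral_lintegral_swap, ← lintegral_const_mul'' _ (by fun_prop)]
    · refine lintegral_mono fun x => ?_
      rw [lintegral_mul_const _ (by fun_prop)]
      refine mul_le_mul_left ?_ _
      rw [← lintegral_sub_right_eq_self k x]
      exact lintegral_mono' hm le_rfl
    · exact hkm.aemeasurable.mul (hw.comp_snd.pow_const 2)
  have h2 : 2 * ∫⁻ x, w x * ∫⁻ y, k (x - y) * w y ∂m ∂m
      ≤ 2 * ((∫⁻ z, k z) * ∫⁻ x, w x ^ 2 ∂m) := by
    calc _ = ∫⁻ x, ∫⁻ y, k (x - y) * (2 * (w x * w y)) ∂m ∂m := by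
          rw [← lintegral_const_mul' _ _ (by norm_num)]
          refine lintegral_congr fun x => ?_
          rw [← lintegral_const_mul' _ _ (hwt x), ← lintegral_const_mul' _ _ (by norm_num)]
          refine lintegral_congr fun y => ?_
          ring
      _ ≤ ∫⁻ x, (∫⁻ y, k (x - y) * w x ^ 2 ∂m) + ∫⁻ y, k (x - y) * w y ^ 2 ∂m ∂m := by
          refine lintegral_mono fun x => ?_
          rw [← lintegral_add_left (by fun_prop)]
          refine lintegral_mono fun y => ?_
          rw [← mul_add]
          exact mul_le_mul_right (two_mul_le _ _ (hwt x) (hwt y)) _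
      _ = _ + _ := by
          apply lintegral_add_left'
          have : ∀ x, ∫⁻ y, k (x - y) * w x ^ 2 ∂m = (∫⁻ y, k (x - y) ∂m) * w x ^ 2 :=
            fun x => lintegral_mul_const _ (by fun_prop)
          simp only [this]
          exact (hkm.lintegral_prod_right').aemeasurable.mul (hw.pow_const 2)
      _ ≤ _ := by rw [two_mul]; exact add_le_add A B
  exact (ENNReal.mul_le_mul_iff_right (by norm_num) (by norm_num)).1 h2

lemma measurableSet_UHP : MeasurableSet UHP := measurableSet_lt measurable_const measurable_snd

lemma energy_bound (lam μ ν T : ℝ) (hl : 0 < lam) (hT : 0 ≤ T)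
    (hTl : 2 / (Real.exp (2 * T) + 1) ≤ 1 / lam) (ω : ℝ × ℝ → ℝ) (h : InAdm μ ν ω) :
    Efun lam ω ≤ T / (4 * π) * ν ^ 2 := by
  obtain ⟨h0, h1, h2, -, -, hν⟩ := h
  set m := volume.restrict UHP with hm
  have h0' : ∀ᵐ x ∂m, 0 ≤ ω x := by
    filter_upwards [ae_restrict_mem measurableSet_UHP] with x hx using h0 x hx
  set w : ℝ × ℝ → ENNReal := fun x => ENNReal.ofReal (ω x) with hw
  have hwm : AEMeasurable w m := h1.aemeasurable.ennreal_ofReal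
  have I1 : ∫⁻ x, w x ∂m = ENNReal.ofReal (∫ x, ω x ∂m) :=
    (ofReal_integral_eq_lintegral_ofReal h1 h0').symm
  have I2 : ∫⁻ x, w x ^ 2 ∂m = ENNReal.ofReal (∫ x, ω x ^ 2 ∂m) := by
    rw [ofReal_integral_eq_lintegral_ofReal h2 (Eventually.of_forall fun x => sq_nonneg _)]
    apply lintegral_congr_ae
    filter_upwards [h0'] with x hx
    rw [ENNReal.ofReal_pow hx]
  have hN : 0 ≤ ∫ x, ω x ∂m := integral_nonneg_of_ae h0'
  have hX : 0 ≤ ∫ x, ω x ^ 2 ∂m := integral_nonneg fun x => sq_nonneg _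
  have key : ENNReal.ofReal (∫ x, ω x * Gop ω x ∂m) ≤
      ENNReal.ofReal (T / (2 * π) * (∫ x, ω x ∂m) ^ 2 + 1 / lam * ∫ x, ω x ^ 2 ∂m) := by
    calc _ ≤ ∫⁻ x, ENNReal.ofReal (ω x * Gop ω x) ∂m := ofReal_integral_le _ _
      _ ≤ ∫⁻ x, w x * ∫⁻ y, (ENNReal.ofReal (T / (2 * π)) + k2 T (x - y)) * w y ∂m ∂m := by
          apply lintegral_mono_ae
          filter_upwards [h0'] with x hx
          rw [ENNReal.ofReal_mul hx]
          refine mul_le_mul_right ?_ _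
          refine (ofReal_integral_le _ _).trans ?_
          apply lintegral_mono_ae
          filter_upwards [h0'] with y hy
          rw [ENNReal.ofReal_mul' hy]
          refine mul_le_mul_left ?_ _
          refine le_trans (ENNReal.ofReal_le_ofReal ?_) (gk_le T hT (x - y))
          have : 0 ≤ Gker (reflPt x) y := gk_nonneg _
          show Gker x y - Gker (reflPt x) y ≤ Gker x y
          linarith
      _ = ENNReal.ofReal (T / (2 * π)) * (∫⁻ x, w x ∂m) ^ 2
          + ∫⁻ x, w x * ∫⁻ y, k2 T (x - y) * w y ∂m ∂m := by
          rw [pow_two, ← mul_assoc, ← lintegral_const_mul'' _ hwm,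
            ← lintegral_add_left' (by fun_prop)]
          refine lintegral_congr fun x => ?_
          simp only [add_mul]
          rw [lintegral_add_left' (by fun_prop), lintegral_const_mul'' _ hwm]
          ring
      _ ≤ ENNReal.ofReal (T / (2 * π)) * (∫⁻ x, w x ∂m) ^ 2
          + ENNReal.ofReal (1 / lam) * ∫⁻ x, w x ^ 2 ∂m := by
          gcongr
          refine (young m Measure.restrict_le_self w (k2 T) hwm (measurable_k2 T)
            (fun x => ENNReal.ofReal_ne_top)).trans ?_
          rw [lintegral_k2]
          gcongr
      _ = _ := by
          rw [I1, I2, ← ENNReal.ofReal_pow hN, ← ENNReal.ofReal_mul (by positivity),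
            ← ENNReal.ofReal_mul (by positivity), ← ENNReal.ofReal_add (by positivity) (by positivity)]
  have key2 := (ENNReal.ofReal_le_ofReal_iff (by positivity)).1 key
  have hN2 : (∫ x, ω x ∂m) ^ 2 ≤ ν ^ 2 := pow_le_pow_left₀ hN hν 2
  have h3 : T / (2 * π) * (∫ x, ω x ∂m) ^ 2 ≤ T / (2 * π) * ν ^ 2 := by gcongr
  unfold Efun kineticE
  rw [← hm]
  have e1 : T / (4 * π) * ν ^ 2 = 1 / 2 * (T / (2 * π) * ν ^ 2) := by
    have := Real.pi_pos
    field_simp; ring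
  have e2 : 1 / (2 * lam) * ∫ x, ω x ^ 2 ∂m = 1 / 2 * (1 / lam * ∫ x, ω x ^ 2 ∂m) := by
    field_simp
  rw [e1, e2]
  linarith

lemma T_ok (lam : ℝ) (hl : 1 < lam) :
    2 / (Real.exp (2 * (3 * lam ^ ((1:ℝ)/3))) + 1) ≤ 1 / lam := by
  set s := lam ^ ((1:ℝ)/3) with hs
  have hs0 : 0 < s := by positivity
  have h3 : s ^ 3 = lam := by
    rw [hs, ← Real.rpow_natCast, ← Real.rpow_mul (by linarith)]; norm_num
  have h := Real.pow_div_factorial_le_exp (2 * (3 * s)) (by positivity) 3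
  have e : (2 * (3 * s)) ^ 3 / ((Nat.factorial 3 : ℕ) : ℝ) = 36 * lam := by
    rw [← h3]; norm_num [Nat.factorial]; ring
  rw [e] at h
  rw [div_le_div_iff₀ (by positivity) (by linarith)]
  linarith

/-- the square carrying the test vorticity -/
def Qs (h R : ℝ) : Set (ℝ × ℝ) := Set.Icc 0 R ×ˢ Set.Icc h (h + R)

lemma measurableSet_Qs (h R : ℝ) : MeasurableSet (Qs h R) := measurableSet_Icc.prod measurableSet_Icc

lemma Qs_sub {h R : ℝ} (hh : 0 < h) : Qs h R ⊆ UHP := by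
  rintro x ⟨-, hx⟩
  exact lt_of_lt_of_le hh hx.1

lemma vol_rect (a b c d : ℝ) (hab : a ≤ b) (hcd : c ≤ d) :
    volume.real (Set.Icc a b ×ˢ Set.Icc c d) = (b - a) * (d - c) := by
  rw [Measure.volume_eq_prod, measureReal_prod_prod, Real.volume_real_Icc_of_le hab,
    Real.volume_real_Icc_of_le hcd]

lemma vol_Qs {h R : ℝ} (hR : 0 ≤ R) : volume.real (Qs h R) = R ^ 2 := by
  rw [Qs, vol_rect _ _ _ _ hR (by linarith)]; ring

lemma vol_Qs_lt (h R : ℝ) : volume (Qs h R) < ⊤ := (isCompact_Icc.prod isCompact_Icc).measure_lt_top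

lemma integral_test {h R c : ℝ} (hh : 0 < h) (f : ℝ × ℝ → ℝ) :
    ∫ x in UHP, f x * (Qs h R).indicator (fun _ => c) x = c * ∫ x in Qs h R, f x := by
  have : (fun x => f x * (Qs h R).indicator (fun _ => c) x)
      = (Qs h R).indicator (fun x => c * f x) := by
    ext x
    by_cases hx : x ∈ Qs h R <;> simp [hx, mul_comm]
  rw [this, setIntegral_indicator (measurableSet_Qs h R), Set.inter_eq_right.2 (Qs_sub hh),
    integral_const_mul]

lemma integrable_gk_left (x : ℝ × ℝ) : Integrable (fun y => gk (x - y)) :=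
  integrable_gk.comp_sub_left x

lemma setInt_gk_le (s : Set (ℝ × ℝ)) (x : ℝ × ℝ) : ∫ y in s, gk (x - y) ≤ 1 := by
  calc _ ≤ ∫ y, gk (x - y) := setIntegral_le_integral (integrable_gk_left x)
            (Eventually.of_forall fun y => gk_nonneg _)
    _ = 1 := by rw [integral_sub_left_eq_self gk volume x, integral_gk]

lemma GUHP_eq (x y : ℝ × ℝ) : GUHP x y = gk (x - y) - gk (reflPt x - y) := rfl

lemma setInt_GUHP (s : Set (ℝ × ℝ)) (x : ℝ × ℝ) :
    ∫ y in s, GUHP x y = (∫ y in s, gk (x - y)) - ∫ y in s, gk (reflPt x - y) := by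
  simp only [GUHP_eq]
  exact integral_sub (integrable_gk_left x).integrableOn (integrable_gk_left _).integrableOn

lemma refl_le {h R : ℝ} (hh : 0 < h) {x y : ℝ × ℝ} (hx : x ∈ Qs h R) (hy : y ∈ Qs h R) :
    gk (reflPt x - y) ≤ 1 / h := by
  have hx2 : h ≤ x.2 := hx.2.1
  have hy2 : h ≤ y.2 := hy.2.1
  have hr : h ≤ rad (reflPt x - y) := by
    apply Real.le_sqrt_of_sq_le
    simp only [reflPt, Prod.fst_sub, Prod.snd_sub]
    nlinarith [sq_nonneg (x.1 - y.1)]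
  have h1 : K0 (rad (reflPt x - y)) ≤ 1 / h :=
    (K0_le (hh.trans_le hr)).trans (one_div_le_one_div_of_le hh hr)
  have h2 : 1 / (2 * π) ≤ 1 := by
    rw [div_le_one (by positivity)]
    linarith [Real.pi_gt_three]
  calc gk (reflPt x - y) ≤ 1 * (1 / h) := by
        unfold gk
        exact mul_le_mul h2 h1 (K0_nonneg _) (by norm_num)
    _ = _ := one_mul _

/-- box around the origin -/
def Bx (L : ℝ) : Set (ℝ × ℝ) := Set.Icc (-L) L ×ˢ Set.Icc (-L) L

/-- inner square -/
def In (h R L : ℝ) : Set (ℝ × ℝ) := Set.Icc L (R - L) ×ˢ Set.Icc (h + L) (h + R - L)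

lemma measurableSet_Bx (L : ℝ) : MeasurableSet (Bx L) := measurableSet_Icc.prod measurableSet_Icc

lemma measurableSet_In (h R L : ℝ) : MeasurableSet (In h R L) :=
  measurableSet_Icc.prod measurableSet_Icc

lemma inner_le {h R L : ℝ} {x : ℝ × ℝ} (hx : x ∈ In h R L) :
    ∫ z in Bx L, gk z ≤ ∫ y in Qs h R, gk (x - y) := by
  rw [← integral_indicator (measurableSet_Bx L), ← integral_indicator (measurableSet_Qs h R),
    ← integral_sub_left_eq_self ((Bx L).indicator gk) volume x]
  refine integral_mono ?_ ?_ ?_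
  · exact (integrable_gk.indicator (measurableSet_Bx L)).comp_sub_left x
  · exact (integrable_gk_left x).indicator (measurableSet_Qs h R)
  · intro y
    by_cases hy : x - y ∈ Bx L
    · have : y ∈ Qs h R := by
        obtain ⟨⟨a1, a2⟩, ⟨a3, a4⟩⟩ := hx
        obtain ⟨⟨b1, b2⟩, ⟨b3, b4⟩⟩ := hy
        simp only [Prod.fst_sub, Prod.snd_sub] at b1 b2 b3 b4
        exact ⟨⟨by linarith, by linarith⟩, ⟨by linarith, by linarith⟩⟩
      simp [hy, this]
    · simp only [Set.indicator_of_notMem hy]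
      exact Set.indicator_nonneg (fun _ _ => gk_nonneg _) _

lemma H_lower {h R L : ℝ} (hh : 0 < h) (hR : 0 ≤ R) {x : ℝ × ℝ} (hx : x ∈ Qs h R) :
    (In h R L).indicator (fun _ => ∫ z in Bx L, gk z) x - R ^ 2 / h ≤ ∫ y in Qs h R, GUHP x y := by
  rw [setInt_GUHP]
  have h1 : ∫ y in Qs h R, gk (reflPt x - y) ≤ R ^ 2 / h := by
    calc _ ≤ ∫ y in Qs h R, 1 / h :=
          setIntegral_mono_on (integrable_gk_left _).integrableOn
            (integrableOn_const (vol_Qs_lt h R).ne) (measurableSet_Qs h R)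
            (fun y hy => refl_le hh hx hy)
      _ = _ := by
          rw [setIntegral_const, vol_Qs hR, smul_eq_mul]; ring
  have h2 : (In h R L).indicator (fun _ => ∫ z in Bx L, gk z) x ≤ ∫ y in Qs h R, gk (x - y) := by
    by_cases hxi : x ∈ In h R L
    · simpa [hxi] using inner_le hxi
    · simp only [Set.indicator_of_notMem hxi]
      exact integral_nonneg fun _ => gk_nonneg _
  linarith

lemma H_integrable (h R : ℝ) : IntegrableOn (fun x => ∫ y in Qs h R, GUHP x y) (Qs h R) := by
  refine Measure.integrableOn_of_bounded (M := 1) (vol_Qs_lt h R).ne ?_ ?_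
  · have hg := measurable_gk
    have hm : StronglyMeasurable (fun p : (ℝ × ℝ) × (ℝ × ℝ) => GUHP p.1 p.2) := by
      apply Measurable.stronglyMeasurable
      simp only [GUHP_eq, reflPt]
      fun_prop
    exact (hm.integral_prod_right' (ν := volume.restrict (Qs h R))).aestronglyMeasurable
  · refine Eventually.of_forall fun x => ?_
    rw [setInt_GUHP, Real.norm_eq_abs, abs_le]
    have h1 := setInt_gk_le (Qs h R) x
    have h2 := setInt_gk_le (Qs h R) (reflPt x)
    have h3 : 0 ≤ ∫ y in Qs h R, gk (x - y) := integral_nonneg fun _ => gk_nonneg _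
    have h4 : 0 ≤ ∫ y in Qs h R, gk (reflPt x - y) := integral_nonneg fun _ => gk_nonneg _
    constructor <;> linarith

lemma HH_lower {h R L : ℝ} (hh : 0 < h) (hL : 0 ≤ L) (hR : 2 * L ≤ R) :
    (∫ z in Bx L, gk z) * (R - 2 * L) ^ 2 - R ^ 4 / h
      ≤ ∫ x in Qs h R, ∫ y in Qs h R, GUHP x y := by
  have hR0 : 0 ≤ R := by linarith
  have hsub : In h R L ⊆ Qs h R := by
    rintro x ⟨⟨a1, a2⟩, ⟨a3, a4⟩⟩
    exact ⟨⟨by linarith, by linarith⟩, ⟨by linarith, by linarith⟩⟩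
  have i1 : IntegrableOn ((In h R L).indicator (fun _ => ∫ z in Bx L, gk z)) (Qs h R) :=
    IntegrableOn.indicator (integrableOn_const (vol_Qs_lt h R).ne) (measurableSet_In h R L)
  have i2 : IntegrableOn (fun _ : ℝ × ℝ => R ^ 2 / h) (Qs h R) :=
    integrableOn_const (vol_Qs_lt h R).ne
  refine le_trans (le_of_eq ?_) (setIntegral_mono_on (i1.sub i2) (H_integrable h R)
    (measurableSet_Qs h R) (fun x hx => H_lower (L := L) hh hR0 hx))
  simp only [Pi.sub_apply]
  rw [integral_sub i1 i2, setIntegral_const, vol_Qs hR0,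
    setIntegral_indicator (measurableSet_In h R L), Set.inter_eq_right.2 hsub, setIntegral_const,
    In, vol_rect _ _ _ _ (by linarith) (by linarith), smul_eq_mul, smul_eq_mul]
  ring

lemma exists_params {lam : ℝ} (hl : 1 < lam) :
    ∃ L R : ℝ, 0 ≤ L ∧ 2 * L < R ∧ R ^ 2 / lam < (∫ z in Bx L, gk z) * (R - 2 * L) ^ 2 := by
  have hU : ⋃ n : ℕ, Bx (n : ℝ) = Set.univ := by
    rw [Set.eq_univ_iff_forall]
    intro z
    obtain ⟨n, hn⟩ := exists_nat_ge (max |z.1| |z.2|)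
    rw [Set.mem_iUnion]
    exact ⟨n, abs_le.1 ((le_max_left _ _).trans hn), abs_le.1 ((le_max_right _ _).trans hn)⟩
  have ht : Tendsto (fun n : ℕ => ∫ z in Bx (n : ℝ), gk z) atTop (nhds 1) := by
    have := tendsto_setIntegral_of_monotone (f := gk) (μ := volume) (s := fun n : ℕ => Bx (n : ℝ))
      (fun n => measurableSet_Bx _) ?_ integrable_gk.integrableOn
    · rwa [hU, setIntegral_univ, integral_gk] at this
    · intro a b hab
      have : (a : ℝ) ≤ b := by exact_mod_cast hab
      exact Set.prod_mono (Set.Icc_subset_Icc (by linarith) this)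
        (Set.Icc_subset_Icc (by linarith) this)
  have h1 : 1 / lam < 1 := by rw [div_lt_one (by linarith)]; exact hl
  obtain ⟨n, hn⟩ := (ht.eventually (lt_mem_nhds h1)).exists
  set p := ∫ z in Bx (n : ℝ), gk z
  have h2 : Tendsto (fun R : ℝ => p * (1 - 2 * n / R) ^ 2) atTop (nhds p) := by
    have : Tendsto (fun R : ℝ => 2 * (n : ℝ) / R) atTop (nhds 0) :=
      tendsto_id.const_div_atTop _
    simpa using ((this.const_sub 1).pow 2).const_mul p
  obtain ⟨R, hR1, hR2⟩ := ((h2.eventually (lt_mem_nhds hn)).and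
    (eventually_gt_atTop (2 * (n : ℝ)))).exists
  have hn0 : (0 : ℝ) ≤ n := Nat.cast_nonneg n
  have hR0 : 0 < R := by linarith
  refine ⟨n, R, hn0, hR2, ?_⟩
  have h3 := mul_lt_mul_of_pos_right hR1 (pow_pos hR0 2)
  have e : p * (1 - 2 * n / R) ^ 2 * R ^ 2 = p * (R - 2 * n) ^ 2 := by field_simp
  rw [e] at h3
  calc R ^ 2 / lam = 1 / lam * R ^ 2 := by ring
    _ < _ := h3

lemma exists_test {lam μ ν : ℝ} (hl : 1 < lam) (hμ : 0 < μ) (hν : 0 < ν) :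
    ∃ ω, InAdm μ ν ω ∧ 0 < Efun lam ω := by
  obtain ⟨L, R, hL, hLR, hD⟩ := exists_params hl
  set p := ∫ z in Bx L, gk z
  set D := p * (R - 2 * L) ^ 2 - R ^ 2 / lam with hDdef
  have hD0 : 0 < D := by linarith
  have hR0 : 0 < R := by linarith
  obtain ⟨h, hh⟩ : ∃ h, h = R ^ 4 / D + μ / ν := ⟨_, rfl⟩
  have hh0 : 0 < h := by rw [hh]; positivity
  have hhν : μ ≤ ν * h := by
    have : ν * h = ν * (R ^ 4 / D) + μ := by rw [hh]; field_simp
    have : 0 < ν * (R ^ 4 / D) := by positivity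
    linarith
  have hhD : R ^ 4 / h < D := by
    rw [div_lt_iff₀ hh0]
    have : D * h = R ^ 4 + D * (μ / ν) := by rw [hh]; field_simp
    have : 0 < D * (μ / ν) := by positivity
    linarith
  have hQ := measurableSet_Qs h R
  have hfin := (vol_Qs_lt h R).ne
  set P := ∫ x in Qs h R, x.2 with hP
  have iP : IntegrableOn (fun x : ℝ × ℝ => x.2) (Qs h R) :=
    continuous_snd.continuousOn.integrableOn_compact (isCompact_Icc.prod isCompact_Icc)
  have hPl : h * R ^ 2 ≤ P := by
    have : ∫ x in Qs h R, h ≤ P :=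
      setIntegral_mono_on (integrableOn_const hfin) iP hQ (fun x hx => hx.2.1)
    rw [setIntegral_const, vol_Qs hR0.le, smul_eq_mul] at this
    linarith
  have hP0 : 0 < P := lt_of_lt_of_le (by positivity) hPl
  obtain ⟨c, hc⟩ : ∃ c, c = μ / P := ⟨_, rfl⟩
  have hc0 : 0 < c := by rw [hc]; positivity
  have hcP : c * P = μ := by rw [hc]; field_simp
  have ic : Integrable ((Qs h R).indicator (fun _ : ℝ × ℝ => c)) :=
    (integrable_indicator_iff hQ).2 (integrableOn_const hfin)
  have esq : ∀ x, ((Qs h R).indicator (fun _ : ℝ × ℝ => c) x) ^ 2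
      = c * (Qs h R).indicator (fun _ : ℝ × ℝ => c) x := by
    intro x
    by_cases hx : x ∈ Qs h R <;> simp [hx, pow_two]
  have emul : (fun x : ℝ × ℝ => x.2 * (Qs h R).indicator (fun _ : ℝ × ℝ => c) x)
      = (Qs h R).indicator (fun x => x.2 * c) := by
    ext x
    by_cases hx : x ∈ Qs h R <;> simp [hx]
  refine ⟨(Qs h R).indicator (fun _ => c), ⟨?_, ic.integrableOn, ?_, ?_, ?_, ?_⟩, ?_⟩
  · exact fun x _ => Set.indicator_nonneg (fun _ _ => hc0.le) x
  · simp only [esq]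
    exact (ic.const_mul c).integrableOn
  · rw [emul]
    exact ((integrable_indicator_iff hQ).2 (iP.mul_const c)).integrableOn
  · rw [impulse, integral_test hh0 (fun x => x.2)]
    exact hcP
  · have := integral_test (R := R) (c := c) hh0 (fun _ => 1)
    simp only [one_mul] at this
    rw [this, setIntegral_const, vol_Qs hR0.le, smul_eq_mul, mul_one]
    have h1 : c * (h * R ^ 2) ≤ ν * h := by
      have := mul_le_mul_of_nonneg_left hPl hc0.le
      linarith
    have : (c * R ^ 2) * h ≤ ν * h := by linarith
    exact le_of_mul_le_mul_right this hh0
  · have e1 : ∀ x, Gop ((Qs h R).indicator (fun _ => c)) x = c * ∫ y in Qs h R, GUHP x y :=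
      fun x => integral_test hh0 _
    have e2 : ∫ x in UHP, ((Qs h R).indicator (fun _ : ℝ × ℝ => c) x) ^ 2 = c * (c * R ^ 2) := by
      simp only [esq]
      rw [integral_test hh0 (fun _ => c), setIntegral_const, vol_Qs hR0.le, smul_eq_mul]
      ring
    have e3 : ∫ x in UHP, (Qs h R).indicator (fun _ : ℝ × ℝ => c) x *
        Gop ((Qs h R).indicator (fun _ => c)) x
        = c * (c * ∫ x in Qs h R, ∫ y in Qs h R, GUHP x y) := by
      simp only [e1]
      simp_rw [mul_comm ((Qs h R).indicator (fun _ : ℝ × ℝ => c) _)]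
      rw [integral_test hh0, integral_const_mul]
    rw [Efun, kineticE, e2, e3]
    have hlow := HH_lower (R := R) hh0 hL hLR.le
    have hpos : 0 < (∫ x in Qs h R, ∫ y in Qs h R, GUHP x y) - R ^ 2 / lam := by
      linarith
    have : 1 / 2 * (c * (c * ∫ x in Qs h R, ∫ y in Qs h R, GUHP x y))
        - 1 / (2 * lam) * (c * (c * R ^ 2))
        = 1 / 2 * (c * (c * ((∫ x in Qs h R, ∫ y in Qs h R, GUHP x y) - R ^ 2 / lam))) := by
      have : lam ≠ 0 := by linarith
      field_simp
    rw [this]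
    positivity

end LambAux

/-- `0 < S_{μ,ν,λ} < ∞` with the bound `S_{μ,ν,λ} ≤ C λ^{1/3} ν²`. -/
theorem stmt5 :
    ∃ C : ℝ, 0 < C ∧ ∀ lam μ ν : ℝ, 1 < lam → 0 < μ → 0 < ν → μ * varrho lam ≤ ν →
      BddAbove {s : ℝ | ∃ ω, InAdm μ ν ω ∧ s = Efun lam ω} ∧
      0 < Sval lam μ ν ∧ Sval lam μ ν ≤ C * lam ^ ((1 : ℝ) / 3) * ν ^ 2 := by
  refine ⟨1, one_pos, fun lam μ ν hl hμ hν _ => ?_⟩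
  have hub : ∀ s ∈ {s : ℝ | ∃ ω, InAdm μ ν ω ∧ s = Efun lam ω},
      s ≤ 1 * lam ^ ((1 : ℝ) / 3) * ν ^ 2 := by
    rintro s ⟨ω, hω, rfl⟩
    have hs : 0 < lam ^ ((1 : ℝ) / 3) := Real.rpow_pos_of_pos (by linarith) _
    refine (LambAux.energy_bound lam μ ν (3 * lam ^ ((1 : ℝ) / 3)) (by linarith) (by linarith)
      (LambAux.T_ok lam hl) ω hω).trans ?_
    refine mul_le_mul_of_nonneg_right ?_ (sq_nonneg ν)
    rw [div_le_iff₀ (by positivity)]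
    nlinarith [Real.pi_gt_three]
  have hb : BddAbove {s : ℝ | ∃ ω, InAdm μ ν ω ∧ s = Efun lam ω} := ⟨_, hub⟩
  obtain ⟨ω, hω, hpos⟩ := LambAux.exists_test hl hμ hν
  exact ⟨hb, lt_csSup_of_lt hb ⟨ω, hω, rfl⟩ hpos, csSup_le ⟨_, ω, hω, rfl⟩ hub⟩
end
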